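/- arXiv:1503.04415 — 2 statements merged into one kernel-verified Lean document; each statement's English description precedes it below -/
import Mathlib

section
/- Let ρ be a symmetric probability measure on ℝ which is not the Dirac mass at 0 and which has a finite fifth moment. Denote by σ² the variance of ρ and by μ₄ its fourth moment. Then, under the measures μ̃_{n,ρ}, the random variable S_n/(n^{1/4}·√T_n) converges in distribution, as n → ∞, to the probability distribution on ℝ with density s ↦ (4μ₄/(3σ⁴))^{1/4} · Γ(1/4)^{-1} · exp(−μ₄ s⁴/(12σ⁴)) with respect to Lebesgue measure. -/
open MeasureTheory Filter Topology Real

/-- `Sₙ(x) = x₁ + ⋯ + xₙ`. -/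
noncomputable def S (n : ℕ) (x : Fin n → ℝ) : ℝ := ∑ i, x i

/-- `Tₙ(x) = x₁² + ⋯ + xₙ²`. -/
noncomputable def T (n : ℕ) (x : Fin n → ℝ) : ℝ := ∑ i, (x i) ^ 2

/-- The (unnormalized) density `exp((1/2) Sₙ²/Tₙ) 1{Tₙ > 0}` of the Curie-Weiss model
of SOC with respect to `ρ^⊗n`. -/
noncomputable def weight (n : ℕ) (x : Fin n → ℝ) : ℝ :=
  if 0 < T n x then Real.exp (S n x ^ 2 / (2 * T n x)) else 0

/-- The normalization constant `Zₙ`. -/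
noncomputable def Z (ρ : Measure ℝ) (n : ℕ) : ℝ :=
  ∫ x, weight n x ∂(Measure.pi fun _ : Fin n => ρ)

/-- The measure `μ̃_{n,ρ}` on `ℝⁿ` with density `(1/Zₙ) exp((1/2) Sₙ²/Tₙ) 1{Tₙ > 0}`
with respect to `ρ^⊗n`. -/
noncomputable def tildeMu (ρ : Measure ℝ) (n : ℕ) : Measure (Fin n → ℝ) :=
  (ENNReal.ofReal (Z ρ n))⁻¹ •
    (Measure.pi fun _ : Fin n => ρ).withDensity fun x => ENNReal.ofReal (weight n x)

theorem cosh_le_one_third_exp (y : ℝ) :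
    Real.cosh y ≤ 2 / 3 * (1 + y ^ 2 / 2) + 1 / 3 * Real.exp (y ^ 2 / 2) := by
  have h1 := Real.hasSum_cosh y
  have h2 : HasSum (fun n : ℕ => (y ^ 2 / 2) ^ n / (n.factorial : ℝ)) (Real.exp (y ^ 2 / 2)) := by
    rw [Real.exp_eq_exp_ℝ]; exact NormedSpace.expSeries_div_hasSum_exp _
  have h3 : HasSum (fun n : ℕ => if n ∈ Finset.range 2 then (y ^ 2 / 2) ^ n else 0)
      (∑ n ∈ Finset.range 2, (y ^ 2 / 2) ^ n) := by
    have : HasSum (fun n : ℕ => if n ∈ Finset.range 2 then (y ^ 2 / 2) ^ n else 0)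
        (∑ n ∈ Finset.range 2, if n ∈ Finset.range 2 then (y ^ 2 / 2) ^ n else 0) :=
      hasSum_sum_of_ne_finset_zero fun b hb => if_neg hb
    rwa [Finset.sum_congr rfl fun i hi => if_pos hi] at this
  have h4 := (h3.mul_left (2 / 3)).add (h2.mul_left (1 / 3))
  have h5 : ∑ n ∈ Finset.range 2, (y ^ 2 / 2) ^ n = 1 + y ^ 2 / 2 := by
    simp [Finset.sum_range_succ]
  rw [h5] at h4
  refine hasSum_le (fun n => ?_) h1 h4
  match n with
  | 0 => norm_num
  | 1 => norm_num; linarith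
  | n + 2 =>
    have hf : (3 : ℝ) * 2 ^ (n + 2) * (n + 2).factorial ≤ (2 * (n + 2)).factorial := by
      induction n with
      | zero => norm_num [Nat.factorial]
      | succ k ih =>
        have e : 2 * (k + 1 + 2) = (2 * (k + 2) + 1) + 1 := by ring
        rw [e, Nat.factorial_succ (2 * (k + 2) + 1), Nat.factorial_succ (2 * (k + 2)),
          show k + 1 + 2 = (k + 2) + 1 by ring, Nat.factorial_succ (k + 2), pow_succ]
        push_cast
        have hp : (0:ℝ) < (2 * (k + 2)).factorial := by positivity
        have hq : (0:ℝ) < (k + 2).factorial := by positivity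
        have : (3 * (2 ^ (k + 2) * 2) * (((k:ℝ) + 2 + 1) * ((k + 2).factorial : ℝ)))
          = 2 * (k + 3) * (3 * 2 ^ (k + 2) * ((k + 2).factorial : ℝ)) := by ring
        rw [this]
        calc _ ≤ 2 * ((k:ℝ) + 3) * (2 * (k + 2)).factorial := by gcongr
          _ ≤ _ := by
            rw [← mul_assoc]
            apply mul_le_mul_of_nonneg_right _ hp.le
            have : (0:ℝ) ≤ k := by positivity
            nlinarith
    have hm : n + 2 ∉ Finset.range 2 := by simp
    rw [if_neg hm, mul_zero, zero_add, div_pow, ← pow_mul, div_div, ← mul_div_assoc, one_div_mul_eq_div,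
      div_div]
    have hy : 0 ≤ y ^ (2 * (n + 2)) := by rw [pow_mul]; positivity
    apply div_le_div_of_nonneg_left hy (by positivity)
    rwa [← mul_assoc]

theorem cosh_le_exp_half_sq_sub (y : ℝ) :
    Real.cosh y ≤ Real.exp (y ^ 2 / 2 - 1 / 15 * ((y ^ 2 / 2) ^ 2 / (1 + y ^ 2 / 2))) := by
  set s := y ^ 2 / 2 with hs
  have hs0 : 0 ≤ s := by positivity
  rcases le_total s 8 with h8 | h8
  · have h1 := cosh_le_one_third_exp y
    rw [← hs] at h1
    refine h1.trans ?_
    have h2 : (1 + s + s ^ 2 / 2) ≤ Real.exp s := Real.quadratic_le_exp_of_nonneg hs0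
    set w := s ^ 2 / (1 + s) with hw
    have hww : w * (1 + s) = s ^ 2 := by rw [hw]; field_simp
    have hw0 : 0 ≤ w := by positivity
    rw [Real.exp_sub, le_div_iff₀ (Real.exp_pos _)]
    have h3 : Real.exp (1 / 15 * w) * (1 - 1 / 15 * w) ≤ 1 := by
      have := Real.one_sub_le_exp_neg (1 / 15 * w)
      calc _ ≤ Real.exp (1 / 15 * w) * Real.exp (-(1 / 15 * w)) := by gcongr
        _ = 1 := by rw [← Real.exp_add]; simp
    have hw15 : 1 / 15 * w < 1 := by
      nlinarith
    have h4 : Real.exp (1 / 15 * w) ≤ 1 / (1 - 1 / 15 * w) := by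
      rw [le_div_iff₀ (by linarith)]; exact h3
    have h5 : (2 / 3 * (1 + s) + 1 / 3 * Real.exp s) ≤ Real.exp s * (1 - 1 / 15 * w) := by
      have : w * 10 ≤ w * (10 + 10 * s) := by nlinarith
      have h6 : (1 + s) * 2 / 3 ≤ (2 / 3 - 1 / 15 * w) * (1 + s + s ^ 2 / 2) := by
        nlinarith [mul_nonneg hw0 hs0, mul_nonneg hw0 (mul_nonneg hs0 (sub_nonneg.2 h8))]
      have h7 : (2 / 3 - 1 / 15 * w) * (1 + s + s ^ 2 / 2) ≤ (2 / 3 - 1 / 15 * w) * Real.exp s := by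
        apply mul_le_mul_of_nonneg_left h2
        nlinarith
      linarith
    calc _ ≤ (Real.exp s * (1 - 1 / 15 * w)) * Real.exp (1 / 15 * w) := by gcongr
      _ = Real.exp s * (Real.exp (1 / 15 * w) * (1 - 1 / 15 * w)) := by ring
      _ ≤ Real.exp s * 1 := by gcongr
      _ = _ := by ring
  · have h1 : Real.cosh y ≤ Real.exp |y| := by
      rw [← Real.cosh_abs, Real.cosh_eq]
      have : Real.exp (-|y|) ≤ Real.exp |y| := Real.exp_le_exp.2 (by linarith [abs_nonneg y])
      linarith
    refine h1.trans (Real.exp_le_exp.2 ?_)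
    have hy : 4 ≤ |y| := by
      apply abs_le_of_sq_le_sq' _ (abs_nonneg y) |>.2
      rw [sq_abs]; linarith
    have h2 : |y| ≤ s / 2 := by
      rw [hs, ← sq_abs]; nlinarith
    have h3 : s ^ 2 / (1 + s) ≤ s := by
      rw [div_le_iff₀ (by linarith)]; nlinarith
    linarith

theorem abs_log_cosh_sub_le (y : ℝ) :
    |Real.log (Real.cosh y) - y ^ 2 / 2 + y ^ 4 / 12| ≤ 32 * |y| ^ 5 := by
  rcases le_total |y| (1 / 2) with h | h
  · have e1 := Real.exp_bound (x := y) (by linarith) (n := 6) (by norm_num)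
    have e2 := Real.exp_bound (x := -y) (by rw [abs_neg]; linarith) (n := 6) (by norm_num)
    rw [abs_neg] at e2
    simp only [Finset.sum_range_succ, Finset.sum_range_zero] at e1 e2
    norm_num [Nat.factorial] at e1 e2
    have hy2 : y ^ 2 ≤ 1 / 4 := by rw [← sq_abs]; nlinarith [abs_nonneg y]
    set a := |y| with ha
    have ha0 : 0 ≤ a := abs_nonneg y
    have hya : y ^ 2 = a ^ 2 := (sq_abs y).symm
    set z := Real.cosh y - 1 with hz
    have h1 : |z - (a ^ 2 / 2 + a ^ 4 / 24)| ≤ a ^ 6 * (7 / 4320) := by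
      rw [abs_le] at *
      have : a ^ 4 = y ^ 4 := by rw [show 4 = 2 * 2 by norm_num, pow_mul, pow_mul, hya]
      rw [hz, Real.cosh_eq, this, ← hya]
      constructor <;> linarith [e1.1, e1.2, e2.1, e2.2]
    have hz0 : 0 ≤ z := by rw [hz]; linarith [Real.one_le_cosh y]
    have h4 : a ^ 4 ≤ a ^ 2 / 4 := by nlinarith [sq_nonneg a]
    have h6 : a ^ 6 ≤ a ^ 4 / 4 := by nlinarith [sq_nonneg (a^2)]
    have hz1 : z ≤ a ^ 2 := by
      have := (abs_le.1 h1).2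
      nlinarith
    have hzlt : |-z| < 1 := by rw [abs_neg, abs_of_nonneg hz0]; linarith
    have h2 := Real.abs_log_sub_add_sum_range_le hzlt 2
    have hc : 1 - -z = Real.cosh y := by rw [hz]; ring
    rw [hc] at h2
    simp only [Finset.sum_range_succ, Finset.sum_range_zero] at h2
    norm_num at h2
    rw [abs_of_nonneg hz0] at h2
    have h3 : z ^ 3 / (1 - z) ≤ 2 * a ^ 6 := by
      rw [div_le_iff₀ (by linarith)]
      have : z ^ 3 ≤ (a ^ 2) ^ 3 := by gcongr
      nlinarith [pow_nonneg ha0 6]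
    have h5 : a ^ 6 ≤ a ^ 5 / 2 := by nlinarith [pow_nonneg ha0 5]
    have h7 : |z ^ 2 - a ^ 4 / 4| ≤ a ^ 6 := by
      have : z ^ 2 - a ^ 4 / 4 = (z - a ^ 2 / 2) * (z + a ^ 2 / 2) := by ring
      rw [this, abs_mul, abs_of_nonneg (a := z + a ^ 2 / 2) (by positivity)]
      have h8 : |z - a ^ 2 / 2| ≤ a ^ 4 / 2 := by
        rw [abs_le] at *
        constructor <;> nlinarith [h1.1, h1.2, pow_nonneg ha0 4]
      calc _ ≤ a ^ 4 / 2 * (2 * a ^ 2) := by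
            gcongr
            linarith [sq_nonneg a]
        _ = a ^ 6 := by ring
    have h4y : y ^ 4 = a ^ 4 := by rw [show 4 = 2 * 2 by norm_num, pow_mul, pow_mul, hya]
    rw [hya, h4y]
    rw [abs_le] at *
    constructor <;> nlinarith [h1.1, h1.2, h7.1, h7.2, h2.1, h2.2, pow_nonneg ha0 5]
  · have hu : Real.log (Real.cosh y) ≤ y ^ 2 / 2 := by
      rw [← Real.log_exp (y ^ 2 / 2)]
      exact Real.log_le_log (Real.cosh_pos _) (Real.cosh_le_exp_half_sq y)
    have hl : 0 ≤ Real.log (Real.cosh y) := Real.log_nonneg (Real.one_le_cosh y)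
    have hya : y ^ 2 = |y| ^ 2 := (sq_abs y).symm
    have h4y : y ^ 4 = |y| ^ 4 := by rw [show 4 = 2 * 2 by norm_num, pow_mul, pow_mul, hya]
    rw [h4y]
    rw [hya] at *
    set a := |y|
    have h5 : a ^ 4 ≤ 2 * a ^ 5 := by nlinarith [pow_nonneg (abs_nonneg y) 4]
    have h2 : a ^ 3 ≤ 2 * a ^ 4 := by nlinarith [pow_nonneg (abs_nonneg y) 3]
    have h3 : a ^ 2 ≤ 2 * a ^ 3 := by nlinarith [pow_nonneg (abs_nonneg y) 2]
    rw [abs_le]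
    constructor <;> nlinarith [pow_nonneg (abs_nonneg y) 4, pow_nonneg (abs_nonneg y) 2]

/-- The function `exp(-r²u²/2) ∏ᵢ cosh(r u xᵢ/√Tₙ) 1{Tₙ > 0}`. -/
noncomputable def coshWeight (n : ℕ) (r u : ℝ) (x : Fin n → ℝ) : ℝ :=
  if 0 < T n x then
    Real.exp (-(r ^ 2 * u ^ 2 / 2)) * ∏ i, Real.cosh (r * u * x i / Real.sqrt (T n x))
  else 0

theorem coshWeight_nonneg (n : ℕ) (r u : ℝ) (x : Fin n → ℝ) : 0 ≤ coshWeight n r u x := by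
  unfold coshWeight
  split_ifs
  · exact mul_nonneg (Real.exp_pos _).le (Finset.prod_nonneg fun i _ => (Real.cosh_pos _).le)
  · exact le_rfl

theorem coshWeight_le (n : ℕ) {r : ℝ} (hr : 1 ≤ r) (hrn : r ^ 4 = n) (u : ℝ) (x : Fin n → ℝ) :
    coshWeight n r u x ≤ Real.exp (1 / 15) * Real.exp (-(1 / 30) * u ^ 2) := by
  unfold coshWeight
  split_ifs with hT
  swap
  · positivity
  set s : Fin n → ℝ := fun i => (r * u * x i / Real.sqrt (T n x)) ^ 2 / 2 with hs
  have hs0 : ∀ i, 0 ≤ s i := fun i => by positivity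
  have hsum : ∑ i, s i = r ^ 2 * u ^ 2 / 2 := by
    simp only [hs, div_pow, mul_pow, Real.sq_sqrt hT.le]
    rw [← Finset.sum_div, ← Finset.sum_div, ← Finset.mul_sum]
    change r ^ 2 * u ^ 2 * T n x / T n x / 2 = _
    rw [mul_div_cancel_right₀ _ hT.ne']
  have h1 : ∏ i, Real.cosh (r * u * x i / Real.sqrt (T n x)) ≤
      Real.exp (∑ i, (s i - 1 / 15 * (s i ^ 2 / (1 + s i)))) := by
    rw [Real.exp_sum]
    exact Finset.prod_le_prod (fun i _ => (Real.cosh_pos _).le)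
      fun i _ => cosh_le_exp_half_sq_sub _
  have h2 := Finset.sq_sum_div_le_sum_sq_div Finset.univ s (g := fun i => 1 + s i)
    fun i _ => by linarith [hs0 i]
  rw [Finset.sum_sub_distrib, ← Finset.mul_sum, hsum] at h1
  rw [Finset.sum_add_distrib, hsum] at h2
  simp only [Finset.sum_const, Finset.card_univ, Fintype.card_fin, nsmul_eq_mul, mul_one] at h2
  rw [← hrn] at h2
  have h3 : (u ^ 2 - 2) / 2 ≤ (r ^ 2 * u ^ 2 / 2) ^ 2 / (r ^ 4 + r ^ 2 * u ^ 2 / 2) := by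
    rw [le_div_iff₀ (by positivity)]
    have hr2 : 1 ≤ r ^ 2 := one_le_pow₀ hr
    have : (r ^ 2 * u ^ 2 / 2) ^ 2 - (u ^ 2 - 2) / 2 * (r ^ 4 + r ^ 2 * u ^ 2 / 2) =
      r ^ 2 / 4 * (u ^ 4 * (r ^ 2 - 1) - 2 * u ^ 2 * (r ^ 2 - 1) + 4 * r ^ 2) := by ring
    have h4 : 0 ≤ u ^ 4 * (r ^ 2 - 1) - 2 * u ^ 2 * (r ^ 2 - 1) + 4 * r ^ 2 := by
      nlinarith [mul_nonneg (sq_nonneg (u ^ 2 - 1)) (sub_nonneg.2 hr2)]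
    have : 0 ≤ r ^ 2 / 4 * (u ^ 4 * (r ^ 2 - 1) - 2 * u ^ 2 * (r ^ 2 - 1) + 4 * r ^ 2) := by
      positivity
    linarith
  calc _ ≤ _ := mul_le_mul_of_nonneg_left h1 (Real.exp_pos _).le
    _ ≤ _ := by
      rw [← Real.exp_add, ← Real.exp_add, Real.exp_le_exp]
      linarith

theorem tendsto_coshWeight {x : ℕ → ℝ} {v m k : ℝ} (hv : 0 < v)
    (h2 : Tendsto (fun n : ℕ => (∑ i ∈ Finset.range n, x i ^ 2) / n) atTop (𝓝 v))
    (h4 : Tendsto (fun n : ℕ => (∑ i ∈ Finset.range n, x i ^ 4) / n) atTop (𝓝 m))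
    (h5 : Tendsto (fun n : ℕ => (∑ i ∈ Finset.range n, |x i| ^ 5) / n) atTop (𝓝 k))
    {r : ℕ → ℝ} (hr : Tendsto r atTop atTop) (hrn : ∀ n, r n ^ 4 = n) (u : ℝ) :
    Tendsto (fun n : ℕ => coshWeight n (r n) u fun i => x i) atTop
      (𝓝 (Real.exp (-(u ^ 4 * m / (12 * v ^ 2))))) := by
  let V : ℕ → ℝ := fun n => (∑ i ∈ Finset.range n, x i ^ 2) / n
  let M : ℕ → ℝ := fun n => (∑ i ∈ Finset.range n, x i ^ 4) / n
  let K : ℕ → ℝ := fun n => (∑ i ∈ Finset.range n, |x i| ^ 5) / n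
  let E : ℕ → ℝ := fun n => ∑ i : Fin n,
    (Real.log (Real.cosh (r n * u * x i / Real.sqrt (T n fun i => x i)))
      - (r n * u * x i / Real.sqrt (T n fun i => x i)) ^ 2 / 2)
  have hev : ∀ᶠ n in atTop, 0 < V n ∧ 0 < r n :=
    (h2.eventually (lt_mem_nhds hv)).and (hr.eventually_gt_atTop 0)
  have key : ∀ᶠ n in atTop, (coshWeight n (r n) u fun i => x i) = Real.exp (E n) ∧
      |E n + u ^ 4 * M n / (12 * V n ^ 2)| ≤
        32 * (|u| ^ 5 * K n / (r n * Real.sqrt (V n) ^ 5)) := by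
    filter_upwards [hev] with n ⟨hVn, hrpos⟩
    have hn : (0 : ℝ) < n := by rw [← hrn]; positivity
    have hTV : T n (fun i => x i) = r n ^ 4 * V n := by
      simp only [T, V, hrn]
      rw [Fin.sum_univ_eq_sum_range (fun i => x i ^ 2) n]
      field_simp
    have hT : 0 < T n (fun i => x i) := by rw [hTV]; positivity
    have hsq : Real.sqrt (T n (fun i => x i)) = r n ^ 2 * Real.sqrt (V n) := by
      rw [hTV, Real.sqrt_mul (by positivity), show r n ^ 4 = (r n ^ 2) ^ 2 by ring,
        Real.sqrt_sq (by positivity)]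
    have hsV : 0 < Real.sqrt (V n) := Real.sqrt_pos.2 hVn
    have hy : ∀ i : Fin n, r n * u * x i / Real.sqrt (T n fun i => x i) =
        u * x i / (r n * Real.sqrt (V n)) := fun i => by
      rw [hsq]; field_simp
    constructor
    · rw [coshWeight, if_pos hT]
      simp only [E, Finset.sum_sub_distrib]
      have hsum : ∑ i : Fin n, (r n * u * x i / Real.sqrt (T n fun i => x i)) ^ 2 / 2 =
          r n ^ 2 * u ^ 2 / 2 := by
        simp only [div_pow, mul_pow, Real.sq_sqrt hT.le]
        rw [← Finset.sum_div, ← Finset.sum_div, ← Finset.mul_sum]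
        change r n ^ 2 * u ^ 2 * T n (fun i => x i) / T n (fun i => x i) / 2 = _
        rw [mul_div_cancel_right₀ _ hT.ne']
      rw [hsum, sub_eq_neg_add, Real.exp_add, Real.exp_sum]
      congr 1
      exact Finset.prod_congr rfl fun i _ => (Real.exp_log (Real.cosh_pos _)).symm
    · have e4 : u ^ 4 * M n / (12 * V n ^ 2) =
          ∑ i : Fin n, (r n * u * x i / Real.sqrt (T n fun i => x i)) ^ 4 / 12 := by
        simp only [hy, div_pow, mul_pow]
        rw [← Finset.sum_div, ← Finset.sum_div, ← Finset.mul_sum,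
          Fin.sum_univ_eq_sum_range (fun i => x i ^ 4) n, hrn,
          show Real.sqrt (V n) ^ 4 = (Real.sqrt (V n) ^ 2) ^ 2 by ring, Real.sq_sqrt hVn.le]
        simp only [M]
        field_simp
      have e5 : 32 * (|u| ^ 5 * K n / (r n * Real.sqrt (V n) ^ 5)) =
          ∑ i : Fin n, 32 * |r n * u * x i / Real.sqrt (T n fun i => x i)| ^ 5 := by
        simp only [hy, abs_div, abs_mul, div_pow, mul_pow, abs_of_pos hrpos, abs_of_pos hsV]
        rw [← Finset.mul_sum, ← Finset.sum_div, ← Finset.mul_sum,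
          Fin.sum_univ_eq_sum_range (fun i => |x i| ^ 5) n,
          show r n ^ 5 = r n ^ 4 * r n by ring, hrn]
        simp only [K]
        field_simp
      rw [e4, e5, ← Finset.sum_add_distrib]
      refine (Finset.abs_sum_le_sum_abs _ _).trans (Finset.sum_le_sum fun i _ => ?_)
      exact abs_log_cosh_sub_le _
  have hlim1 : Tendsto (fun n => u ^ 4 * M n / (12 * V n ^ 2)) atTop
      (𝓝 (u ^ 4 * m / (12 * v ^ 2))) :=
    (h4.const_mul _).div ((h2.pow 2).const_mul _) (by positivity)
  have hlim2 : Tendsto (fun n => 32 * (|u| ^ 5 * K n / (r n * Real.sqrt (V n) ^ 5))) atTop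
      (𝓝 0) := by
    have hd : Tendsto (fun n => r n * Real.sqrt (V n) ^ 5) atTop atTop :=
      hr.atTop_mul_pos (C := Real.sqrt v ^ 5) (by positivity) ((h2.sqrt).pow 5)
    simpa using ((h5.const_mul (|u| ^ 5)).div_atTop hd).const_mul 32
  have hE0 : Tendsto (fun n => E n + u ^ 4 * M n / (12 * V n ^ 2)) atTop (𝓝 0) :=
    squeeze_zero_norm' (key.mono fun n h => h.2) hlim2
  have hE : Tendsto E atTop (𝓝 (-(u ^ 4 * m / (12 * v ^ 2)))) := by
    simpa using hE0.sub hlim1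
  exact ((Real.continuous_exp.tendsto _).comp hE).congr' (key.mono fun n h => h.1.symm)

theorem measurable_S (n : ℕ) : Measurable (S n) :=
  Finset.measurable_sum _ fun i _ => measurable_pi_apply i

theorem measurable_T (n : ℕ) : Measurable (T n) :=
  Finset.measurable_sum _ fun i _ => (measurable_pi_apply i).pow_const 2

theorem measurable_weight (n : ℕ) : Measurable (weight n) :=
  Measurable.ite (measurableSet_lt measurable_const (measurable_T n))
    (((measurable_S n).pow_const 2).div ((measurable_T n).const_mul 2)).exp measurable_const

theorem weight_nonneg (n : ℕ) (x : Fin n → ℝ) : 0 ≤ weight n x := by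
  unfold weight; split_ifs <;> positivity

theorem sq_S_le (n : ℕ) (x : Fin n → ℝ) : S n x ^ 2 ≤ n * T n x := by
  simpa [S, T] using sq_sum_le_card_mul_sum_sq (s := Finset.univ) (f := x)

theorem weight_le (n : ℕ) (x : Fin n → ℝ) : weight n x ≤ Real.exp (n / 2) := by
  unfold weight
  split_ifs with h
  · rw [Real.exp_le_exp, div_le_div_iff₀ (by positivity) two_pos]
    nlinarith [sq_S_le n x]
  · positivity

/-- The function `exp(-r²u²/2 + r u Sₙ/√Tₙ) 1{Tₙ > 0}`, whose integral in `u` is proportional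
to `weight`. -/
noncomputable def expWeight (n : ℕ) (r u : ℝ) (x : Fin n → ℝ) : ℝ :=
  if 0 < T n x then
    Real.exp (-(r ^ 2 * u ^ 2 / 2)) * Real.exp (r * u * (S n x / Real.sqrt (T n x)))
  else 0

theorem expWeight_nonneg (n : ℕ) (r u : ℝ) (x : Fin n → ℝ) : 0 ≤ expWeight n r u x := by
  unfold expWeight; split_ifs <;> positivity

theorem measurable_expWeight (n : ℕ) (r : ℝ) :
    Measurable fun p : (Fin n → ℝ) × ℝ => expWeight n r p.2 p.1 := by
  have hT : Measurable fun p : (Fin n → ℝ) × ℝ => T n p.1 := (measurable_T n).comp measurable_fst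
  have hS : Measurable fun p : (Fin n → ℝ) × ℝ => S n p.1 := (measurable_S n).comp measurable_fst
  refine Measurable.ite (measurableSet_lt measurable_const hT) ?_ measurable_const
  exact (by fun_prop : Measurable fun p : (Fin n → ℝ) × ℝ =>
    Real.exp (-(r ^ 2 * p.2 ^ 2 / 2))).mul
      ((measurable_snd.const_mul r).mul (hS.div hT.sqrt)).exp

theorem expWeight_le (n : ℕ) (r u : ℝ) (x : Fin n → ℝ) :
    expWeight n r u x ≤ Real.exp n * Real.exp (-(r ^ 2 / 4) * u ^ 2) := by
  unfold expWeight
  split_ifs with hT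
  · rw [← Real.exp_add, ← Real.exp_add, Real.exp_le_exp]
    set s := S n x / Real.sqrt (T n x) with hs
    have : s ^ 2 ≤ n := by
      rw [hs, div_pow, Real.sq_sqrt hT.le, div_le_iff₀ hT]
      exact sq_S_le n x
    nlinarith [sq_nonneg (r * u / 2 - s)]
  · positivity

theorem integrable_expWeight (ρ : Measure ℝ) [IsProbabilityMeasure ρ] (n : ℕ) (r u : ℝ) :
    Integrable (expWeight n r u) (Measure.pi fun _ : Fin n => ρ) := by
  refine Integrable.of_bound (C := Real.exp n * Real.exp (-(r ^ 2 / 4) * u ^ 2)) ?_ ?_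
  · exact ((measurable_expWeight n r).comp measurable_prodMk_right).aestronglyMeasurable
  · refine Eventually.of_forall fun x => ?_
    rw [Real.norm_of_nonneg (expWeight_nonneg n r u x)]
    exact expWeight_le n r u x

theorem coshWeight_eq_sum (n : ℕ) (r u : ℝ) (x : Fin n → ℝ) :
    coshWeight n r u x = ∑ ε ∈ Fintype.piFinset fun _ : Fin n => ({1, -1} : Finset ℝ),
      (1 / 2) ^ n * expWeight n r u fun i => ε i * x i := by
  have hT : ∀ ε ∈ Fintype.piFinset fun _ : Fin n => ({1, -1} : Finset ℝ),
      T n (fun i => ε i * x i) = T n x := by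
    intro ε hε
    refine Finset.sum_congr rfl fun i _ => ?_
    have := Fintype.mem_piFinset.1 hε i
    simp only [Finset.mem_insert, Finset.mem_singleton] at this
    rcases this with h | h <;> simp [h]
  by_cases h : 0 < T n x
  · rw [coshWeight, if_pos h]
    have hc : ∀ i, Real.cosh (r * u * x i / Real.sqrt (T n x)) =
        ∑ e ∈ ({1, -1} : Finset ℝ), 1 / 2 * Real.exp (e * (r * u * x i / Real.sqrt (T n x))) := by
      intro i
      rw [Finset.sum_pair (by norm_num), Real.cosh_eq]
      ring_nf
    rw [Finset.prod_congr rfl fun i _ => hc i, Finset.prod_univ_sum, Finset.mul_sum]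
    refine Finset.sum_congr rfl fun ε hε => ?_
    rw [expWeight, hT ε hε, if_pos h, Finset.prod_mul_distrib, ← Real.exp_sum]
    have : ∑ i, ε i * (r * u * x i / Real.sqrt (T n x)) =
        r * u * (S n (fun i => ε i * x i) / Real.sqrt (T n x)) := by
      rw [S, Finset.sum_div, Finset.mul_sum]
      exact Finset.sum_congr rfl fun i _ => by ring
    rw [this]
    simp only [Finset.prod_const, Finset.card_univ, Fintype.card_fin]
    ring
  · rw [coshWeight, if_neg h, Finset.sum_eq_zero]
    intro ε hε
    rw [expWeight, hT ε hε, if_neg h, mul_zero]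

theorem integral_expWeight_eq (ρ : Measure ℝ) [IsProbabilityMeasure ρ]
    (hsymm : ρ.map (fun x => -x) = ρ) (n : ℕ) (r u : ℝ) :
    ∫ x, expWeight n r u x ∂(Measure.pi fun _ : Fin n => ρ) =
      ∫ x, coshWeight n r u x ∂(Measure.pi fun _ : Fin n => ρ) := by
  have hmp : ∀ ε ∈ Fintype.piFinset fun _ : Fin n => ({1, -1} : Finset ℝ),
      MeasurePreserving (fun (x : Fin n → ℝ) i => ε i * x i)
        (Measure.pi fun _ : Fin n => ρ) (Measure.pi fun _ : Fin n => ρ) := by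
    intro ε hε
    refine measurePreserving_pi (fun _ => ρ) (fun _ => ρ) (f := fun i y => ε i * y) fun i => ?_
    have := Fintype.mem_piFinset.1 hε i
    simp only [Finset.mem_insert, Finset.mem_singleton] at this
    rcases this with h | h
    · simp only [h, one_mul]; exact MeasurePreserving.id ρ
    · simp only [h, neg_one_mul]; exact ⟨measurable_neg, hsymm⟩
  have hm : ∀ (μ : Measure (Fin n → ℝ)), AEStronglyMeasurable (expWeight n r u) μ := fun μ =>
    ((measurable_expWeight n r).comp measurable_prodMk_right).aestronglyMeasurable
  simp_rw [coshWeight_eq_sum]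
  rw [integral_finsetSum]
  · rw [Finset.sum_congr rfl (g := fun _ => (1 / 2) ^ n *
      ∫ x, expWeight n r u x ∂(Measure.pi fun _ : Fin n => ρ))]
    · rw [Finset.sum_const, Fintype.card_piFinset]
      have : ({1, -1} : Finset ℝ).card = 2 := Finset.card_pair (by norm_num)
      simp only [this, Finset.prod_const, Finset.card_univ, Fintype.card_fin, nsmul_eq_mul]
      push_cast
      rw [← mul_assoc, ← mul_pow]
      norm_num
    · intro ε hε
      rw [integral_const_mul]
      congr 1
      conv_rhs => rw [← (hmp ε hε).map_eq]
      rw [integral_map (hmp ε hε).aemeasurable (hm _)]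
  · intro ε hε
    exact ((hmp ε hε).integrable_comp_of_integrable
      (integrable_expWeight ρ n r u)).const_mul _

theorem integral_cexp_mul_expWeight (n : ℕ) {r : ℝ} (hr : 0 < r) (t : ℝ) (x : Fin n → ℝ) :
    ∫ u : ℝ, Complex.exp (u * t * Complex.I) * expWeight n r u x =
      (π / (r ^ 2 / 2) : ℂ) ^ (1 / 2 : ℂ) * Complex.exp (-(t ^ 2 / (2 * r ^ 2))) *
        (weight n x * Complex.exp (t * (S n x / (r * Real.sqrt (T n x)) : ℝ) * Complex.I)) := by
  by_cases hT : 0 < T n x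
  · set s := S n x / Real.sqrt (T n x) with hs
    have hsq : S n x ^ 2 / (2 * T n x) = s ^ 2 / 2 := by
      rw [hs, div_pow, Real.sq_sqrt hT.le]; field_simp
    have hsr : S n x / (r * Real.sqrt (T n x)) = s / r := by
      rw [hs, div_div, mul_comm]
    simp only [expWeight, weight, if_pos hT, hsq, hsr, ← hs]
    have hb : ((-(r ^ 2 / 2) : ℝ) : ℂ).re < 0 := by
      rw [Complex.ofReal_re]; have : 0 < r ^ 2 := by positivity
      linarith
    have h := integral_cexp_quadratic hb (t * Complex.I + r * s) 0
    have hrc : (r : ℂ) ≠ 0 := by exact_mod_cast hr.ne'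
    have hI : Complex.I ^ 2 = -1 := Complex.I_sq
    calc _ = ∫ u : ℝ, Complex.exp (((-(r ^ 2 / 2) : ℝ) : ℂ) * u ^ 2 +
          (t * Complex.I + r * s) * u + 0) := by
          congr 1 with u
          push_cast
          rw [← Complex.exp_add, ← Complex.exp_add]
          congr 1
          ring
      _ = _ := by
          rw [h]
          push_cast
          rw [neg_neg, mul_assoc, ← Complex.exp_add, ← Complex.exp_add]
          congr 2
          field_simp
          ring_nf
          rw [hI]
          ring
  · simp [expWeight, weight, hT]

theorem integral_weight_mul_cexp (ρ : Measure ℝ) [IsProbabilityMeasure ρ]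
    (hsymm : ρ.map (fun x => -x) = ρ) (n : ℕ) {r : ℝ} (hr : 0 < r) (t : ℝ) :
    ∫ u : ℝ, Complex.exp (u * t * Complex.I) *
        (∫ x, coshWeight n r u x ∂(Measure.pi fun _ : Fin n => ρ) : ℝ) =
      (π / (r ^ 2 / 2) : ℂ) ^ (1 / 2 : ℂ) * Complex.exp (-(t ^ 2 / (2 * r ^ 2))) *
        ∫ x, (weight n x * Complex.exp (t * (S n x / (r * Real.sqrt (T n x)) : ℝ) * Complex.I))
          ∂(Measure.pi fun _ : Fin n => ρ) := by
  have hint : Integrable (fun p : (Fin n → ℝ) × ℝ =>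
      Complex.exp (p.2 * t * Complex.I) * (expWeight n r p.2 p.1 : ℂ))
      ((Measure.pi fun _ : Fin n => ρ).prod volume) := by
    have hg : Integrable (fun u : ℝ => Real.exp n * Real.exp (-(r ^ 2 / 4) * u ^ 2)) :=
      (integrable_exp_neg_mul_sq (by positivity)).const_mul _
    refine (hg.comp_snd (Measure.pi fun _ : Fin n => ρ)).mono' ?_ ?_
    · exact ((by fun_prop : Measurable fun p : (Fin n → ℝ) × ℝ =>
        Complex.exp (p.2 * t * Complex.I)).mul
          (Complex.measurable_ofReal.comp (measurable_expWeight n r))).aestronglyMeasurable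
    · refine Eventually.of_forall fun p => ?_
      rw [norm_mul, ← Complex.ofReal_mul, Complex.norm_exp_ofReal_mul_I, one_mul,
        Complex.norm_real, Real.norm_of_nonneg (expWeight_nonneg _ _ _ _)]
      exact expWeight_le n r p.2 p.1
  calc _ = ∫ u : ℝ, ∫ x, Complex.exp (u * t * Complex.I) * (expWeight n r u x : ℂ)
        ∂(Measure.pi fun _ : Fin n => ρ) := by
        congr 1 with u
        rw [integral_const_mul, ← integral_expWeight_eq ρ hsymm, integral_complex_ofReal]
    _ = ∫ x, (∫ u : ℝ, Complex.exp (u * t * Complex.I) * (expWeight n r u x : ℂ))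
        ∂(Measure.pi fun _ : Fin n => ρ) := (integral_integral_swap hint).symm
    _ = _ := by
        simp_rw [integral_cexp_mul_expWeight n hr]
        rw [integral_const_mul]

theorem measurable_coshWeight (n : ℕ) (r u : ℝ) : Measurable (coshWeight n r u) := by
  refine Measurable.ite (measurableSet_lt measurable_const (measurable_T n)) ?_ measurable_const
  refine Measurable.const_mul (Finset.measurable_prod _ fun i _ => ?_) _
  exact Real.measurable_cosh.comp
    (((measurable_pi_apply i).const_mul (r * u)).div (measurable_T n).sqrt)

theorem integrable_pow_of_abs_pow (ρ : Measure ℝ) [IsFiniteMeasure ρ] {m : ℕ}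
    (hm : Integrable (fun x : ℝ => |x| ^ m) ρ) (k : ℕ) (hk : k ≤ m) :
    Integrable (fun x : ℝ => x ^ k) ρ := by
  refine ((integrable_const (1 : ℝ)).add hm).mono' (by fun_prop) (Eventually.of_forall fun x => ?_)
  rw [norm_pow, Real.norm_eq_abs, Pi.add_apply]
  rcases le_total |x| 1 with h | h
  · exact (pow_le_one₀ (abs_nonneg x) h).trans (by simp)
  · exact (pow_le_pow_right₀ h hk).trans (by simp)

theorem tendsto_integral_coshWeight (ρ : Measure ℝ) [IsProbabilityMeasure ρ]
    (h5 : Integrable (fun x : ℝ => |x| ^ 5) ρ) (hv : 0 < ∫ x : ℝ, x ^ 2 ∂ρ)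
    {r : ℕ → ℝ} (hr : Tendsto r atTop atTop) (hrn : ∀ n, r n ^ 4 = n) (u : ℝ) :
    Tendsto (fun n : ℕ => ∫ x, coshWeight n (r n) u x ∂(Measure.pi fun _ : Fin n => ρ)) atTop
      (𝓝 (Real.exp (-(u ^ 4 * (∫ x : ℝ, x ^ 4 ∂ρ) / (12 * (∫ x : ℝ, x ^ 2 ∂ρ) ^ 2))))) := by
  obtain ⟨Ω, _, P, X, hXm, hXl, hXi, _⟩ := ProbabilityTheory.exists_iid ℕ ρ
  have hpi : ∀ n : ℕ, P.map (fun ω (i : Fin n) => X i ω) = Measure.pi fun _ : Fin n => ρ := by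
    intro n
    have hi : ProbabilityTheory.iIndepFun (fun i : Fin n => X i) P :=
      hXi.precomp Fin.val_injective
    rw [(ProbabilityTheory.iIndepFun_iff_map_fun_eq_pi_map
      fun i : Fin n => (hXm i).aemeasurable).1 hi]
    congr 1 with i : 1
    exact (hXl i).map_eq
  have hslln : ∀ g : ℝ → ℝ, Measurable g → Integrable g ρ → ∀ᵐ ω ∂P,
      Tendsto (fun n : ℕ => (∑ i ∈ Finset.range n, g (X i ω)) / n) atTop (𝓝 (∫ x, g x ∂ρ)) := by
    intro g hg hgi
    have hid : ∀ i, ProbabilityTheory.IdentDistrib (X i) (X 0) P P := fun i =>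
      ⟨(hXm i).aemeasurable, (hXm 0).aemeasurable, by rw [(hXl i).map_eq, (hXl 0).map_eq]⟩
    have := ProbabilityTheory.strong_law_ae_real (μ := P) (fun i => g ∘ X i) ?_ ?_
      fun i => (hid i).comp hg
    · have he : ∫ ω, (g ∘ X 0) ω ∂P = ∫ x, g x ∂ρ := by
        rw [← (hXl 0).map_eq, integral_map (hXm 0).aemeasurable hg.aestronglyMeasurable]
        rfl
      rw [he] at this
      exact this
    · rw [← (hXl 0).map_eq] at hgi
      exact hgi.comp_measurable (hXm 0)
    · exact fun i j hij => (hXi.indepFun hij).comp hg hg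
  have hpow : ∀ k ≤ 5, Integrable (fun x : ℝ => x ^ k) ρ := integrable_pow_of_abs_pow ρ h5
  have hlim : ∀ᵐ ω ∂P, Tendsto (fun n : ℕ => coshWeight n (r n) u fun i => X i ω) atTop
      (𝓝 (Real.exp (-(u ^ 4 * (∫ x : ℝ, x ^ 4 ∂ρ) / (12 * (∫ x : ℝ, x ^ 2 ∂ρ) ^ 2))))) := by
    filter_upwards [hslln (fun x => x ^ 2) (by fun_prop) (hpow 2 (by norm_num)),
      hslln (fun x => x ^ 4) (by fun_prop) (hpow 4 (by norm_num)),
      hslln (fun x => |x| ^ 5) (by fun_prop) h5] with ω h2 h4 h5'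
    exact tendsto_coshWeight hv h2 h4 h5' hr hrn u
  have hmeas : ∀ n, AEStronglyMeasurable (fun ω => coshWeight n (r n) u fun i => X i ω) P :=
    fun n => ((measurable_coshWeight n (r n) u).comp
      (measurable_pi_lambda _ fun i => hXm i)).aestronglyMeasurable
  have hdct := tendsto_integral_filter_of_dominated_convergence (μ := P) (l := atTop)
    (F := fun n ω => coshWeight n (r n) u fun i => X i ω)
    (fun _ => Real.exp (1 / 15) * Real.exp (-(1 / 30) * u ^ 2))
    (Eventually.of_forall hmeas)
    (by
      filter_upwards [hr.eventually_ge_atTop 1] with n hn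
      refine Eventually.of_forall fun ω => ?_
      rw [Real.norm_of_nonneg (coshWeight_nonneg _ _ _ _)]
      exact coshWeight_le n hn (hrn n) u _)
    (integrable_const _) hlim
  rw [integral_const, probReal_univ, one_smul] at hdct
  refine hdct.congr fun n => ?_
  rw [← hpi n, integral_map (measurable_pi_lambda (fun ω (i : Fin n) => X i ω)
    fun i => hXm i).aemeasurable
    (measurable_coshWeight n (r n) u).aestronglyMeasurable]

theorem tendsto_integral_cexp_mul_coshWeight (ρ : Measure ℝ) [IsProbabilityMeasure ρ]
    (h5 : Integrable (fun x : ℝ => |x| ^ 5) ρ) (hv : 0 < ∫ x : ℝ, x ^ 2 ∂ρ)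
    (hsymm : ρ.map (fun x => -x) = ρ)
    {r : ℕ → ℝ} (hr : Tendsto r atTop atTop) (hrn : ∀ n, r n ^ 4 = n) (t : ℝ) :
    Tendsto (fun n : ℕ => ∫ u : ℝ, Complex.exp (u * t * Complex.I) *
        (∫ x, coshWeight n (r n) u x ∂(Measure.pi fun _ : Fin n => ρ) : ℝ)) atTop
      (𝓝 (∫ u : ℝ, Complex.exp (u * t * Complex.I) *
        (Real.exp (-(u ^ 4 * (∫ x : ℝ, x ^ 4 ∂ρ) / (12 * (∫ x : ℝ, x ^ 2 ∂ρ) ^ 2))) : ℝ))) := by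
  refine tendsto_integral_filter_of_dominated_convergence
    (fun u => Real.exp (1 / 15) * Real.exp (-(1 / 30) * u ^ 2)) ?_ ?_
    ((integrable_exp_neg_mul_sq (by norm_num)).const_mul _) ?_
  · refine Eventually.of_forall fun n => ?_
    refine AEStronglyMeasurable.mul (by fun_prop) ?_
    refine Complex.continuous_ofReal.comp_aestronglyMeasurable ?_
    simp_rw [← integral_expWeight_eq ρ hsymm]
    exact ((measurable_expWeight n (r n)).comp
      measurable_swap).stronglyMeasurable.integral_prod_right.aestronglyMeasurable
  · filter_upwards [hr.eventually_ge_atTop 1] with n hn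
    refine Eventually.of_forall fun u => ?_
    rw [norm_mul, ← Complex.ofReal_mul, Complex.norm_exp_ofReal_mul_I, one_mul,
      Complex.norm_real, Real.norm_of_nonneg (integral_nonneg fun x => coshWeight_nonneg _ _ _ _)]
    have := integral_mono_of_nonneg (μ := Measure.pi fun _ : Fin n => ρ)
      (Eventually.of_forall fun x => coshWeight_nonneg n (r n) u x) (integrable_const _)
      (Eventually.of_forall fun x => coshWeight_le n hn (hrn n) u x)
    simpa using this
  · refine Eventually.of_forall fun u => Tendsto.const_mul _ ?_
    exact (Complex.continuous_ofReal.tendsto _).comp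
      (tendsto_integral_coshWeight ρ h5 hv hr hrn u)

theorem integral_exp_neg_mul_pow_four {a : ℝ} (ha : 0 < a) :
    ∫ s : ℝ, Real.exp (-(a * s ^ 4)) = 1 / 2 * a ^ (-(1 / 4) : ℝ) * Real.Gamma (1 / 4) := by
  have h1 := integral_comp_abs (f := fun s : ℝ => Real.exp (-(a * s ^ 4)))
  have h2 := integral_exp_neg_mul_rpow (p := 4) (by norm_num) ha
  have h3 : ∫ x in Set.Ioi (0 : ℝ), Real.exp (-a * x ^ (4 : ℝ)) =
      ∫ x in Set.Ioi (0 : ℝ), Real.exp (-(a * x ^ 4)) := by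
    congr 1 with x
    rw [show (4 : ℝ) = ((4 : ℕ) : ℝ) by norm_num, Real.rpow_natCast, neg_mul]
  rw [h3] at h2
  simp only [Even.pow_abs (by decide : Even 4)] at h1
  rw [h1, h2, Real.Gamma_add_one (by norm_num)]
  norm_num
  ring

theorem integral_quartic_density {σ2 μ4 : ℝ} (hσ : 0 < σ2) (hμ : 0 < μ4) :
    ∫ s : ℝ, (4 * μ4 / (3 * σ2 ^ 2)) ^ (1 / 4 : ℝ) * (Real.Gamma (1 / 4))⁻¹ *
      Real.exp (-(μ4 * s ^ 4 / (12 * σ2 ^ 2))) = 1 := by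
  set a := μ4 / (12 * σ2 ^ 2) with ha
  have ha0 : 0 < a := by positivity
  have h1 : ∀ s : ℝ, μ4 * s ^ 4 / (12 * σ2 ^ 2) = a * s ^ 4 := fun s => by rw [ha]; ring
  have h2 : 4 * μ4 / (3 * σ2 ^ 2) = 2 ^ (4 : ℝ) * a := by
    rw [ha, show (2 : ℝ) ^ (4 : ℝ) = 16 by norm_num]; field_simp; norm_num
  have hG : Real.Gamma (1 / 4) ≠ 0 := (Real.Gamma_pos_of_pos (by norm_num)).ne'
  simp only [h1]
  rw [integral_const_mul, integral_exp_neg_mul_pow_four ha0, h2,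
    Real.mul_rpow (by positivity) ha0.le, ← Real.rpow_mul (by norm_num), Real.rpow_neg ha0.le]
  have : a ^ (1 / 4 : ℝ) ≠ 0 := by positivity
  norm_num at *
  field_simp

theorem integral_even_pow_pos (ρ : Measure ℝ) [IsProbabilityMeasure ρ]
    (hne : ρ ≠ Measure.dirac 0) {k : ℕ} (hk : Even k) (hk0 : k ≠ 0)
    (hint : Integrable (fun x : ℝ => x ^ k) ρ) : 0 < ∫ x : ℝ, x ^ k ∂ρ := by
  refine lt_of_le_of_ne (integral_nonneg fun x => hk.pow_nonneg x) fun h => hne ?_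
  have h0 := (integral_eq_zero_iff_of_nonneg (fun x => hk.pow_nonneg x) hint).1 h.symm
  have h1 : (id : ℝ → ℝ) =ᵐ[ρ] fun _ => 0 := by
    filter_upwards [h0] with x hx
    exact pow_eq_zero_iff hk0 |>.1 hx
  have h2 : ρ.map id = ρ.map (fun _ => (0 : ℝ)) := Measure.map_congr h1
  rw [Measure.map_id, Measure.map_const, measure_univ, one_smul] at h2
  exact h2

theorem integral_tildeMu {E : Type*} [NormedAddCommGroup E] [NormedSpace ℝ E]
    (ρ : Measure ℝ) (n : ℕ) (hZ : 0 < Z ρ n) (g : (Fin n → ℝ) → E) :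
    ∫ x, g x ∂(tildeMu ρ n) =
      (Z ρ n)⁻¹ • ∫ x, weight n x • g x ∂(Measure.pi fun _ : Fin n => ρ) := by
  rw [tildeMu, integral_smul_measure, ENNReal.toReal_inv, ENNReal.toReal_ofReal hZ.le,
    integral_withDensity_eq_integral_toReal_smul (measurable_weight n).ennreal_ofReal
      (Eventually.of_forall fun _ => ENNReal.ofReal_lt_top)]
  simp only [ENNReal.toReal_ofReal (weight_nonneg n _)]

theorem isProbabilityMeasure_tildeMu (ρ : Measure ℝ) [IsProbabilityMeasure ρ] (n : ℕ)
    (hZ : 0 < Z ρ n) : IsProbabilityMeasure (tildeMu ρ n) := by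
  constructor
  have hint : Integrable (weight n) (Measure.pi fun _ : Fin n => ρ) :=
    Integrable.of_bound (C := Real.exp (n / 2)) (measurable_weight n).aestronglyMeasurable
      (Eventually.of_forall fun x => by
        rw [Real.norm_of_nonneg (weight_nonneg n x)]; exact weight_le n x)
  rw [tildeMu, Measure.smul_apply, withDensity_apply _ MeasurableSet.univ, Measure.restrict_univ,
    ← ofReal_integral_eq_lintegral_ofReal hint (Eventually.of_forall (weight_nonneg n))]
  exact ENNReal.inv_mul_cancel (by simpa using hZ) ENNReal.ofReal_ne_top

/-- if `ρ` is a symmetric probability measure on `ℝ`, not the Dirac mass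
at `0`, with a finite fifth moment, variance `σ²` and fourth moment `μ₄`, then under
`μ̃_{n,ρ}` the random variable `Sₙ/(n^{1/4} √Tₙ)` converges in distribution to the
probability distribution on `ℝ` with density
`s ↦ (4μ₄/(3σ⁴))^{1/4} Γ(1/4)⁻¹ exp(−μ₄ s⁴/(12σ⁴))` with respect to Lebesgue measure. -/
theorem fluctuations_self_normalized_sum
    (ρ : Measure ℝ) [IsProbabilityMeasure ρ]
    (hsymm : ρ.map (fun x => -x) = ρ)
    (hne : ρ ≠ Measure.dirac 0)
    (h5 : Integrable (fun x : ℝ => |x| ^ 5) ρ)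
    (σ2 μ4 : ℝ)
    (hσ2 : σ2 = ProbabilityTheory.variance id ρ)
    (hμ4 : μ4 = ∫ x : ℝ, x ^ 4 ∂ρ) :
    ∀ f : BoundedContinuousFunction ℝ ℝ,
      Tendsto
        (fun n : ℕ =>
          ∫ x, f (S n x / ((n : ℝ) ^ (1/4 : ℝ) * Real.sqrt (T n x))) ∂(tildeMu ρ n))
        atTop
        (𝓝 (∫ s : ℝ, f s *
          ((4 * μ4 / (3 * σ2 ^ 2)) ^ (1/4 : ℝ) * (Real.Gamma (1/4))⁻¹ *
            Real.exp (-(μ4 * s ^ 4 / (12 * σ2 ^ 2)))))) := by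
  have hpow : ∀ k ≤ 5, Integrable (fun x : ℝ => x ^ k) ρ := integrable_pow_of_abs_pow ρ h5
  have hmean : ∫ x, id x ∂ρ = 0 := by
    have h : ∫ x, id x ∂ρ = ∫ x, -id x ∂ρ := by
      conv_lhs => rw [← hsymm]
      rw [integral_map measurable_neg.aemeasurable measurable_id.aestronglyMeasurable]
      rfl
    rw [integral_neg] at h
    linarith
  have hσ2' : σ2 = ∫ x : ℝ, x ^ 2 ∂ρ := by
    rw [hσ2, ProbabilityTheory.variance_of_integral_eq_zero measurable_id.aemeasurable hmean]
    rfl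
  have hσ : 0 < σ2 := hσ2' ▸ integral_even_pow_pos ρ hne (by decide) (by norm_num)
    (hpow 2 (by norm_num))
  have hμ : 0 < μ4 := hμ4 ▸ integral_even_pow_pos ρ hne (by decide) (by norm_num)
    (hpow 4 (by norm_num))
  let r : ℕ → ℝ := fun n => (n : ℝ) ^ (1 / 4 : ℝ)
  have hr : Tendsto r atTop atTop :=
    (tendsto_rpow_atTop (by norm_num)).comp tendsto_natCast_atTop_atTop
  have hrn : ∀ n, r n ^ 4 = n := fun n => by
    rw [← Real.rpow_natCast, ← Real.rpow_mul (by positivity)]; norm_num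
  let c : ℝ := (4 * μ4 / (3 * σ2 ^ 2)) ^ (1 / 4 : ℝ) * (Real.Gamma (1 / 4))⁻¹
  have hG : 0 < Real.Gamma (1 / 4) := Real.Gamma_pos_of_pos (by norm_num)
  have hc : 0 < c := by positivity
  let p : ℝ → ℝ := fun s => c * Real.exp (-(μ4 * s ^ 4 / (12 * σ2 ^ 2)))
  have hp : ∫ s, p s = 1 := integral_quartic_density hσ hμ
  have hp0 : ∀ s, 0 ≤ p s := fun s => by positivity
  have hpm : Measurable p := by fun_prop
  have hpint : Integrable p := by
    by_contra h
    rw [integral_undef h] at hp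
    exact zero_ne_one hp
  let ν : Measure ℝ := volume.withDensity fun s => ENNReal.ofReal (p s)
  have hν : IsProbabilityMeasure ν := ⟨by
    rw [withDensity_apply _ MeasurableSet.univ, Measure.restrict_univ,
      ← ofReal_integral_eq_lintegral_ofReal hpint (Eventually.of_forall hp0), hp,
      ENNReal.ofReal_one]⟩
  have hνint : ∀ {E : Type} [NormedAddCommGroup E] [NormedSpace ℝ E] (g : ℝ → E),
      ∫ s, g s ∂ν = ∫ s, p s • g s := by
    intro E _ _ g
    rw [integral_withDensity_eq_integral_toReal_smul hpm.ennreal_ofReal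
      (Eventually.of_forall fun _ => ENNReal.ofReal_lt_top)]
    simp only [ENNReal.toReal_ofReal (hp0 _)]
  let J : ℕ → ℝ → ℂ := fun n t => ∫ x, (weight n x *
    Complex.exp (t * (S n x / (r n * Real.sqrt (T n x)) : ℝ) * Complex.I))
      ∂(Measure.pi fun _ : Fin n => ρ)
  let κ : ℕ → ℂ := fun n => (π / (r n ^ 2 / 2) : ℂ) ^ (1 / 2 : ℂ)
  let e : ℕ → ℝ → ℂ := fun n t => Complex.exp (-(t ^ 2 / (2 * r n ^ 2)))
  have hJZ : ∀ n, J n 0 = (Z ρ n : ℂ) := fun n => by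
    simp only [J, Z, Complex.ofReal_zero, zero_mul, Complex.exp_zero, mul_one,
      integral_complex_ofReal]
  have hZ0 : ∀ n, 0 ≤ Z ρ n := fun n => integral_nonneg (weight_nonneg n)
  have hlim : ∀ t : ℝ, Tendsto (fun n => κ n * e n t * J n t) atTop
      (𝓝 ((c : ℂ)⁻¹ * charFun ν t)) := by
    intro t
    have h := tendsto_integral_cexp_mul_coshWeight ρ h5 (hσ2' ▸ hσ) hsymm hr hrn t
    rw [← hσ2', ← hμ4] at h
    have hcc : (c : ℂ) ≠ 0 := by exact_mod_cast hc.ne'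
    have hcf : (c : ℂ)⁻¹ * charFun ν t = ∫ u : ℝ, Complex.exp (u * t * Complex.I) *
        (Real.exp (-(u ^ 4 * μ4 / (12 * σ2 ^ 2))) : ℝ) := by
      rw [charFun_apply_real, hνint, ← integral_const_mul]
      congr 1 with u
      simp only [p, Complex.real_smul, Complex.ofReal_mul]
      rw [mul_comm μ4, mul_comm (t : ℂ)]
      field_simp
    rw [hcf]
    refine h.congr' ?_
    filter_upwards [hr.eventually_gt_atTop 0] with n hn
    exact integral_weight_mul_cexp ρ hsymm n hn t
  have hZpos : ∀ᶠ n in atTop, 0 < Z ρ n := by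
    have h0 := hlim 0
    rw [charFun_zero, probReal_univ] at h0
    have hne0 : (c : ℂ)⁻¹ * ((1 : ℝ) : ℂ) ≠ 0 := by
      simpa using hc.ne'
    filter_upwards [h0.eventually_ne hne0] with n hn
    refine lt_of_le_of_ne (hZ0 n) fun h => hn ?_
    rw [hJZ, ← h]; simp
  have hX : ∀ n, Measurable fun x : Fin n → ℝ => S n x / (r n * Real.sqrt (T n x)) := fun n =>
    (measurable_S n).div ((measurable_T n).sqrt.const_mul _)
  have hprob : ∀ n, 0 < Z ρ n → IsProbabilityMeasure
      ((tildeMu ρ n).map fun x => S n x / (r n * Real.sqrt (T n x))) := fun n hn =>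
    haveI := isProbabilityMeasure_tildeMu ρ n hn
    Measure.isProbabilityMeasure_map (hX n).aemeasurable
  let m : ℕ → ProbabilityMeasure ℝ := fun n =>
    if hn : 0 < Z ρ n then
      ⟨(tildeMu ρ n).map fun x => S n x / (r n * Real.sqrt (T n x)), hprob n hn⟩
    else ⟨ν, hν⟩
  have hm : ∀ n, 0 < Z ρ n → (m n : Measure ℝ) =
      (tildeMu ρ n).map fun x => S n x / (r n * Real.sqrt (T n x)) := fun n hn => by
    have h : m n = ⟨_, hprob n hn⟩ := dif_pos hn
    rw [h]; rfl
  have hconv : Tendsto m atTop (𝓝 ⟨ν, hν⟩) := by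
    refine ProbabilityMeasure.tendsto_of_tendsto_charFun fun t => ?_
    have he : Tendsto (fun n => e n t) atTop (𝓝 1) := by
      have h1 : Tendsto (fun n => -(t ^ 2 / (2 * r n ^ 2))) atTop (𝓝 0) := by
        have := ((tendsto_pow_atTop (two_ne_zero)).comp hr).const_mul_atTop (two_pos (α := ℝ))
        simpa using (this.const_div_atTop (t ^ 2)).neg
      have h2 := (Complex.continuous_exp.tendsto _).comp
        ((Complex.continuous_ofReal.tendsto _).comp h1)
      simp only [Complex.ofReal_zero, Complex.exp_zero] at h2
      refine h2.congr fun n => ?_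
      simp only [e, Function.comp]
      push_cast
      rfl
    have h0 := hlim 0
    rw [charFun_zero, probReal_univ] at h0
    have hne0 : (c : ℂ)⁻¹ * ((1 : ℝ) : ℂ) ≠ 0 := by
      simpa using hc.ne'
    have hq := ((hlim t).div h0 hne0).div he one_ne_zero
    have hcc : (c : ℂ) ≠ 0 := by exact_mod_cast hc.ne'
    have hval : (c : ℂ)⁻¹ * charFun ν t / ((c : ℂ)⁻¹ * ((1 : ℝ) : ℂ)) / 1 = charFun ν t := by
      push_cast
      field_simp
    rw [hval] at hq
    refine hq.congr' ?_
    filter_upwards [hZpos, h0.eventually_ne hne0] with n hn hn0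
    have hκ : κ n ≠ 0 := fun h => hn0 (by rw [h]; simp)
    have het : e n t ≠ 0 := Complex.exp_ne_zero _
    have he0 : e n 0 = 1 := by simp [e]
    have hJ0 : (Z ρ n : ℂ) ≠ 0 := by exact_mod_cast hn.ne'
    have hcf : charFun (m n : Measure ℝ) t = (Z ρ n : ℂ)⁻¹ * J n t := by
      rw [hm n hn, charFun_apply_real, integral_map (hX n).aemeasurable (by fun_prop),
        integral_tildeMu ρ n hn]
      simp only [Complex.real_smul, Complex.ofReal_inv, J]
    rw [hcf]
    simp only [Pi.div_apply]
    rw [he0, hJZ]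
    field_simp
  intro f
  have hf := (ProbabilityMeasure.tendsto_iff_forall_integral_tendsto.1 hconv) f
  have hfν : ∫ s, f s ∂ν = ∫ s, f s * p s := by
    rw [hνint]
    congr 1 with s
    rw [smul_eq_mul, mul_comm]
  change Tendsto _ _ (𝓝 (∫ s, f s ∂ν)) at hf
  rw [hfν] at hf
  refine hf.congr' ?_
  filter_upwards [hZpos] with n hn
  rw [hm n hn, integral_map (hX n).aemeasurable f.continuous.aestronglyMeasurable]
end

section
/- There exists a constant c > 0 such that for every n ≥ 1, every z ∈ ℝ, and all real numbers a₁,…,aₙ with a₁²+⋯+aₙ² = 1, one has ∑_{i=1}^{n} g(z·n^{1/4}·aᵢ) ≤ −c·z⁴/(1 + z²/√n), where g(y) = ln cosh y − y²/2. -/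
open Real

/-- The function `g(y) = ln cosh y − y²/2`. -/
noncomputable def g (y : ℝ) : ℝ := Real.log (Real.cosh y) - y ^ 2 / 2

/-- A differentiable function on `[0, ∞)` vanishing at `0` with nonnegative derivative is
nonnegative. -/
lemma nonneg_of_hasDerivAt_nonneg {f f' : ℝ → ℝ} (hf : ∀ x, HasDerivAt f (f' x) x)
    (h0 : f 0 = 0) (hf' : ∀ x, 0 ≤ x → 0 ≤ f' x) {x : ℝ} (hx : 0 ≤ x) : 0 ≤ f x := by
  have hmono : MonotoneOn f (Set.Ici 0) := by
    refine monotoneOn_of_deriv_nonneg (convex_Ici 0)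
      (fun x _ => (hf x).continuousAt.continuousWithinAt)
      (fun x _ => (hf x).differentiableAt.differentiableWithinAt) fun x hx => ?_
    rw [interior_Ici] at hx
    rw [(hf x).deriv]
    exact hf' x (le_of_lt hx)
  simpa [h0] using hmono Set.self_mem_Ici hx hx

lemma sinh_le_mul_cosh {x : ℝ} (hx : 0 ≤ x) : sinh x ≤ x * cosh x := by
  have := nonneg_of_hasDerivAt_nonneg (f := fun x => x * cosh x - sinh x)
    (fun x => ((hasDerivAt_id x).mul (hasDerivAt_cosh x)).sub (hasDerivAt_sinh x)) (by simp)
    (fun x hx => by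
      have := mul_nonneg hx (sinh_nonneg_iff.2 hx)
      simp only [id]
      linarith) hx
  simpa using this

lemma sinh_mul_le_mul_cosh {x : ℝ} (hx : 0 ≤ x) :
    (4 + 4 * x ^ 2) * sinh x ≤ (4 * x + 3 * x ^ 3) * cosh x := by
  have hderiv (x : ℝ) :
      HasDerivAt (fun x => (4 * x + 3 * x ^ 3) * cosh x - (4 + 4 * x ^ 2) * sinh x)
        (x * (5 * (x * cosh x) - 4 * sinh x + 3 * x ^ 2 * sinh x)) x := by
    have hp : HasDerivAt (fun x : ℝ => 4 * x + 3 * x ^ 3) (4 + 9 * x ^ 2) x := by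
      refine (((hasDerivAt_id x).const_mul 4).add
        ((hasDerivAt_pow 3 x).const_mul 3)).congr_deriv ?_
      norm_num
      ring
    have hq : HasDerivAt (fun x : ℝ => 4 + 4 * x ^ 2) (8 * x) x := by
      refine (((hasDerivAt_pow 2 x).const_mul 4).const_add 4).congr_deriv ?_
      norm_num
      ring
    refine ((hp.mul (hasDerivAt_cosh x)).sub (hq.mul (hasDerivAt_sinh x))).congr_deriv ?_
    ring
  have := nonneg_of_hasDerivAt_nonneg hderiv (by simp)
    (fun x hx => by
      have h1 := sinh_le_mul_cosh hx
      have h2 := sinh_nonneg_iff.2 hx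
      have h3 : 0 ≤ 3 * x ^ 2 * sinh x := by positivity
      exact mul_nonneg hx (by linarith)) hx
  linarith

lemma g_le_of_nonneg {x : ℝ} (hx : 0 ≤ x) : g x ≤ -(1 / 16 * (x ^ 4 / (1 + x ^ 2))) := by
  have hderiv (x : ℝ) :
      HasDerivAt (fun x => x ^ 2 / 2 - 1 / 16 * (x ^ 4 / (1 + x ^ 2)) - log (cosh x))
        (x - (2 * x ^ 3 + x ^ 5) / (8 * (1 + x ^ 2) ^ 2) - sinh x / cosh x) x := by
    have hpos : 1 + x ^ 2 ≠ 0 := by positivity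
    refine ((((hasDerivAt_pow 2 x).div_const 2).sub
      (((hasDerivAt_pow 4 x).div ((hasDerivAt_pow 2 x).const_add 1) hpos).const_mul
        (1 / 16))).sub ((hasDerivAt_cosh x).log (cosh_pos x).ne')).congr_deriv ?_
    norm_num
    field_simp
    ring
  have := nonneg_of_hasDerivAt_nonneg hderiv (by simp)
    (fun x hx => by
      have h1 : sinh x / cosh x ≤ (4 * x + 3 * x ^ 3) / (4 + 4 * x ^ 2) := by
        rw [div_le_div_iff₀ (cosh_pos x) (by positivity)]
        linarith [sinh_mul_le_mul_cosh hx]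
      have h2 : x - (2 * x ^ 3 + x ^ 5) / (8 * (1 + x ^ 2) ^ 2)
          - (4 * x + 3 * x ^ 3) / (4 + 4 * x ^ 2) = x ^ 5 / (8 * (1 + x ^ 2) ^ 2) := by
        have : (4 + 4 * x ^ 2) = 4 * (1 + x ^ 2) := by ring
        rw [this]
        field_simp
        ring
      have h3 : 0 ≤ x ^ 5 / (8 * (1 + x ^ 2) ^ 2) := by positivity
      linarith) hx
  rw [g]
  linarith

lemma g_le (x : ℝ) : g x ≤ -(1 / 16 * (x ^ 4 / (1 + x ^ 2))) := by
  simpa [g, Even.pow_abs (show Even 4 by decide)] using g_le_of_nonneg (abs_nonneg x)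

/-- there is a constant `c > 0` such that for every `n ≥ 1`, every `z ∈ ℝ`
and all reals `a₁, …, aₙ` with `a₁² + ⋯ + aₙ² = 1`, one has
`∑_{i=1}^n g(z · n^{1/4} · aᵢ) ≤ − c z⁴ / (1 + z²/√n)`. -/
theorem sum_g_le :
    ∃ c : ℝ, 0 < c ∧ ∀ n : ℕ, 1 ≤ n → ∀ z : ℝ, ∀ a : Fin n → ℝ,
      (∑ i, (a i) ^ 2) = 1 →
      (∑ i, g (z * (n : ℝ) ^ (1/4 : ℝ) * a i)) ≤
        -(c * z ^ 4) / (1 + z ^ 2 / Real.sqrt n) := by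
  refine ⟨1 / 16, by norm_num, fun n hn z a ha => ?_⟩
  have hn0 : (0 : ℝ) < n := by exact_mod_cast hn
  set r : ℝ := (n : ℝ) ^ (1 / 4 : ℝ)
  have hr : r ^ 2 = √n := by
    rw [← rpow_natCast, ← rpow_mul hn0.le, sqrt_eq_rpow]
    norm_num
  have hs : 0 < √(n : ℝ) := sqrt_pos.2 hn0
  have hsum : ∑ i, (z * r * a i) ^ 2 = z ^ 2 * √n := by
    simp only [mul_pow, ← Finset.mul_sum, ha, hr, mul_one]
  have hcs := Finset.sq_sum_div_le_sum_sq_div Finset.univ (fun i => (z * r * a i) ^ 2)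
    (g := fun i => 1 + (z * r * a i) ^ 2) (fun i _ => by positivity)
  rw [Finset.sum_add_distrib, hsum] at hcs
  simp only [← pow_mul, Finset.sum_const, Finset.card_univ, Fintype.card_fin, nsmul_eq_mul,
    mul_one] at hcs
  have heq : (z ^ 2 * √n) ^ 2 / (n + z ^ 2 * √n) = z ^ 4 / (1 + z ^ 2 / √n) := by
    have h : (n : ℝ) = √n ^ 2 := (sq_sqrt hn0.le).symm
    have h' : (n : ℝ) + z ^ 2 * √n = √n ^ 2 * (1 + z ^ 2 / √n) := by
      rw [h, sqrt_sq hs.le]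
      field_simp
    rw [h']
    field_simp
  calc ∑ i, g (z * r * a i)
      ≤ ∑ i, -(1 / 16 * ((z * r * a i) ^ 4 / (1 + (z * r * a i) ^ 2))) :=
        Finset.sum_le_sum fun i _ => g_le _
    _ = -(1 / 16 * ∑ i, (z * r * a i) ^ 4 / (1 + (z * r * a i) ^ 2)) := by
        rw [Finset.sum_neg_distrib, Finset.mul_sum]
    _ ≤ -(1 / 16 * (z ^ 4 / (1 + z ^ 2 / √n))) := by
        rw [← heq]
        linarith
    _ = -(1 / 16 * z ^ 4) / (1 + z ^ 2 / √n) := by ring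
end
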